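/- arXiv:2209.10805 — 2 statements merged into one kernel-verified Lean document; each statement's English description precedes it below -/
import Mathlib

section
/- Let M be a feasible matching in a marriage instance with critical men, and suppose some level assignment satisfies the dominant conditions for M. Then for every feasible matching N with |N| > |M| one has φ(N,M) < φ(M,N). -/
open Classical

universe u v

/-- A marriage instance with critical men: a finite bipartite graph with edge set `E ⊆ A × B`,
a set `C ⊆ A` of critical men, and strict preference orders of each vertex over its
neighbours (`prefA m w w'` : man `m` strictly prefers woman `w` to woman `w'`;
`prefB w m m'` : woman `w` strictly prefers man `m` to man `m'`). -/
structure CritInstance (A : Type u) (B : Type v) where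
  E : Finset (A × B)
  C : Finset A
  prefA : A → B → B → Prop
  prefB : B → A → A → Prop
  prefA_irrefl : ∀ m w, ¬ prefA m w w
  prefA_trans : ∀ m w₁ w₂ w₃, prefA m w₁ w₂ → prefA m w₂ w₃ → prefA m w₁ w₃
  prefA_total : ∀ m w₁ w₂, (m, w₁) ∈ E → (m, w₂) ∈ E → w₁ ≠ w₂ →
    prefA m w₁ w₂ ∨ prefA m w₂ w₁
  prefB_irrefl : ∀ w m, ¬ prefB w m m
  prefB_trans : ∀ w m₁ m₂ m₃, prefB w m₁ m₂ → prefB w m₂ m₃ → prefB w m₁ m₃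
  prefB_total : ∀ w m₁ m₂, (m₁, w) ∈ E → (m₂, w) ∈ E → m₁ ≠ m₂ →
    prefB w m₁ m₂ ∨ prefB w m₂ m₁

namespace CritInstance

variable {A : Type u} {B : Type v}

/-- `M` is a matching: a set of edges in which every vertex has at most one partner. -/
def IsMatching (I : CritInstance A B) (M : Finset (A × B)) : Prop :=
  M ⊆ I.E ∧ (∀ ⦃m w w'⦄, (m, w) ∈ M → (m, w') ∈ M → w = w') ∧
    (∀ ⦃m m' w⦄, (m, w) ∈ M → (m', w) ∈ M → m = m')

/-- Man `m` is matched in `M`. -/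
def ManMatched (M : Finset (A × B)) (m : A) : Prop := ∃ w, (m, w) ∈ M

/-- Woman `w` is matched in `M`. -/
def WomanMatched (M : Finset (A × B)) (w : B) : Prop := ∃ m, (m, w) ∈ M

/-- `M` is feasible: it is a matching and every critical man is matched. -/
def IsFeasible (I : CritInstance A B) (M : Finset (A × B)) : Prop :=
  IsMatching I M ∧ ∀ m ∈ I.C, ManMatched M m

/-- Man `m` prefers matching `M` to matching `N`: he is matched in `M` and either
unmatched in `N` or strictly prefers his `M`-partner to his `N`-partner. -/
def ManPrefers (I : CritInstance A B) (M N : Finset (A × B)) (m : A) : Prop :=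
  ∃ w, (m, w) ∈ M ∧ (¬ ManMatched N m ∨ ∃ w', (m, w') ∈ N ∧ I.prefA m w w')

/-- Woman `w` prefers matching `M` to matching `N`. -/
def WomanPrefers (I : CritInstance A B) (M N : Finset (A × B)) (w : B) : Prop :=
  ∃ m, (m, w) ∈ M ∧ (¬ WomanMatched N w ∨ ∃ m', (m', w) ∈ N ∧ I.prefB w m m')

/-- `phi I M N` is the number of vertices that prefer `M` to `N`. -/
noncomputable def phi [Fintype A] [Fintype B] (I : CritInstance A B)
    (M N : Finset (A × B)) : ℕ :=
  (Finset.univ.filter fun m : A => ManPrefers I M N m).card +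
    (Finset.univ.filter fun w : B => WomanPrefers I M N w).card

/-- `M` is a popular feasible matching. -/
def IsPFM [Fintype A] [Fintype B] (I : CritInstance A B) (M : Finset (A × B)) : Prop :=
  IsFeasible I M ∧ ∀ N, IsFeasible I N → phi I N M ≤ phi I M N

/-- `M` is a minimum size popular feasible matching. -/
def IsMinPFM [Fintype A] [Fintype B] (I : CritInstance A B) (M : Finset (A × B)) : Prop :=
  IsPFM I M ∧ ∀ N, IsPFM I N → M.card ≤ N.card

/-- `M` is a dominant feasible matching. -/
def IsDFM [Fintype A] [Fintype B] (I : CritInstance A B) (M : Finset (A × B)) : Prop :=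
  IsPFM I M ∧ ∀ N, IsFeasible I N → M.card < N.card → phi I N M < phi I M N

/-- `(m,w)` is a `(+1,+1)` edge with respect to `M`: an edge of `E ∖ M` such that `m` is
unmatched or prefers `w` to his partner, and `w` is unmatched or prefers `m` to her partner. -/
def PlusPlus (I : CritInstance A B) (M : Finset (A × B)) (m : A) (w : B) : Prop :=
  (m, w) ∈ I.E ∧ (m, w) ∉ M ∧
    (¬ ManMatched M m ∨ ∃ w', (m, w') ∈ M ∧ I.prefA m w w') ∧
    (¬ WomanMatched M w ∨ ∃ m', (m', w) ∈ M ∧ I.prefB w m m')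

/-- `(m,w)` is a `(−1,−1)` edge with respect to `M`: an edge of `E ∖ M` such that `m` is
matched and prefers his partner to `w`, and `w` is matched and prefers her partner to `m`. -/
def MinusMinus (I : CritInstance A B) (M : Finset (A × B)) (m : A) (w : B) : Prop :=
  (m, w) ∈ I.E ∧ (m, w) ∉ M ∧
    (∃ w', (m, w') ∈ M ∧ I.prefA m w' w) ∧
    (∃ m', (m', w) ∈ M ∧ I.prefB w m' m)

/-- `M` is a stable matching: a matching with no blocking pair. -/
def IsStable (I : CritInstance A B) (M : Finset (A × B)) : Prop :=
  IsMatching I M ∧ ∀ m w, ¬ PlusPlus I M m w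

/-- The min-size conditions for a level assignment `(lA, lB)` with respect to `M`:
(i) matched partners share a level, unmatched vertices have level 0, non-critical men
have level 0; (ii) every `(+1,+1)` edge goes from a man to a strictly higher level woman;
(iii) every edge from a man at level `i` to a woman at level `i − 1` is a `(−1,−1)` edge;
(iv) no edge goes from a man at level `i` to a woman at level `≤ i − 2`. -/
def MinSizeConds (I : CritInstance A B) (M : Finset (A × B))
    (lA : A → ℕ) (lB : B → ℕ) : Prop :=
  (∀ m w, (m, w) ∈ M → lA m = lB w) ∧
  (∀ m, ¬ ManMatched M m → lA m = 0) ∧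
  (∀ w, ¬ WomanMatched M w → lB w = 0) ∧
  (∀ m, m ∉ I.C → lA m = 0) ∧
  (∀ m w, PlusPlus I M m w → lA m < lB w) ∧
  (∀ m w, (m, w) ∈ I.E → lB w + 1 = lA m → MinusMinus I M m w) ∧
  (∀ m w, (m, w) ∈ I.E → ¬ (lB w + 2 ≤ lA m))

/-- The dominant conditions for a level assignment `(lA, lB)` with respect to `M`:
(i) matched partners share a level, unmatched women have level 0, unmatched men have
level 1, non-critical men have level at most 1; (ii)–(iv) as in the min-size conditions. -/
def DomConds (I : CritInstance A B) (M : Finset (A × B))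
    (lA : A → ℕ) (lB : B → ℕ) : Prop :=
  (∀ m w, (m, w) ∈ M → lA m = lB w) ∧
  (∀ m, ¬ ManMatched M m → lA m = 1) ∧
  (∀ w, ¬ WomanMatched M w → lB w = 0) ∧
  (∀ m, m ∉ I.C → lA m ≤ 1) ∧
  (∀ m w, PlusPlus I M m w → lA m < lB w) ∧
  (∀ m w, (m, w) ∈ I.E → lB w + 1 = lA m → MinusMinus I M m w) ∧
  (∀ m w, (m, w) ∈ I.E → ¬ (lB w + 2 ≤ lA m))

/-- Adjacency in the bipartite graph, on the vertex set `A ⊕ B`. -/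
def Adj (I : CritInstance A B) : A ⊕ B → A ⊕ B → Prop
  | Sum.inl m, Sum.inr w => (m, w) ∈ I.E
  | Sum.inr w, Sum.inl m => (m, w) ∈ I.E
  | _, _ => False

/-- The (directed) pair `(u, v)` of vertices spans an edge of the matching `M`. -/
def StepM (M : Finset (A × B)) : A ⊕ B → A ⊕ B → Prop
  | Sum.inl m, Sum.inr w => (m, w) ∈ M
  | Sum.inr w, Sum.inl m => (m, w) ∈ M
  | _, _ => False

/-- The pair `(u, v)` of vertices spans a `(+1,+1)` edge with respect to `M`. -/
def StepPP (I : CritInstance A B) (M : Finset (A × B)) : A ⊕ B → A ⊕ B → Prop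
  | Sum.inl m, Sum.inr w => PlusPlus I M m w
  | Sum.inr w, Sum.inl m => PlusPlus I M m w
  | _, _ => False

/-- The pair `(u, v)` of vertices spans a `(−1,−1)` edge with respect to `M`. -/
def StepMM (I : CritInstance A B) (M : Finset (A × B)) : A ⊕ B → A ⊕ B → Prop
  | Sum.inl m, Sum.inr w => MinusMinus I M m w
  | Sum.inr w, Sum.inl m => MinusMinus I M m w
  | _, _ => False

/-- A vertex of `A ⊕ B` is matched in `M`. -/
def VMatched (M : Finset (A × B)) : A ⊕ B → Prop
  | Sum.inl m => ManMatched M m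
  | Sum.inr w => WomanMatched M w

/-- An `M`-alternating path in the graph: a sequence of distinct vertices
`vert 0, …, vert len` (`len ≥ 1` edges), consecutive vertices adjacent, with
consecutive edges alternately inside and outside `M`. -/
structure AltPath (I : CritInstance A B) (M : Finset (A × B)) where
  len : ℕ
  len_pos : 0 < len
  vert : ℕ → A ⊕ B
  inj : ∀ i j, i ≤ len → j ≤ len → vert i = vert j → i = j
  adj : ∀ i, i < len → Adj I (vert i) (vert (i + 1))
  alternate : ∀ i, i + 1 < len →
    (StepM M (vert i) (vert (i + 1)) ↔ ¬ StepM M (vert (i + 1)) (vert (i + 2)))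

namespace AltPath

variable {I : CritInstance A B} {M : Finset (A × B)}

/-- The number of `(+1,+1)` edges of the path. -/
noncomputable def countPP (ρ : AltPath I M) : ℕ :=
  ((Finset.range ρ.len).filter fun i => StepPP I M (ρ.vert i) (ρ.vert (i + 1))).card

/-- The number of `(−1,−1)` edges of the path. -/
noncomputable def countMM (ρ : AltPath I M) : ℕ :=
  ((Finset.range ρ.len).filter fun i => StepMM I M (ρ.vert i) (ρ.vert (i + 1))).card

/-- The vertex `u` lies on the path. -/
def Mem (ρ : AltPath I M) (u : A ⊕ B) : Prop := ∃ i ≤ ρ.len, ρ.vert i = u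

/-- The set of edges of the path, as a set of pairs in `A × B`. -/
noncomputable def edges (ρ : AltPath I M) : Finset (A × B) :=
  I.E.filter fun e => ∃ i < ρ.len,
    (ρ.vert i = Sum.inl e.1 ∧ ρ.vert (i + 1) = Sum.inr e.2) ∨
    (ρ.vert i = Sum.inr e.2 ∧ ρ.vert (i + 1) = Sum.inl e.1)

end AltPath

/-- An `M`-alternating cycle: a closed sequence of vertices `vert 0, …, vert len = vert 0`
(distinct except for the return), consecutive vertices adjacent, with edges alternately
inside and outside `M`, including around the wrap. -/
structure AltCycle (I : CritInstance A B) (M : Finset (A × B)) where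
  len : ℕ
  len_pos : 0 < len
  vert : ℕ → A ⊕ B
  closed : vert len = vert 0
  inj : ∀ i j, i < len → j < len → vert i = vert j → i = j
  adj : ∀ i, i < len → Adj I (vert i) (vert (i + 1))
  alternate : ∀ i, i + 1 < len →
    (StepM M (vert i) (vert (i + 1)) ↔ ¬ StepM M (vert (i + 1)) (vert (i + 2)))
  alternate_wrap : StepM M (vert (len - 1)) (vert len) ↔ ¬ StepM M (vert 0) (vert 1)

namespace AltCycle

variable {I : CritInstance A B} {M : Finset (A × B)}

/-- The number of `(+1,+1)` edges of the cycle. -/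
noncomputable def countPP (σ : AltCycle I M) : ℕ :=
  ((Finset.range σ.len).filter fun i => StepPP I M (σ.vert i) (σ.vert (i + 1))).card

/-- The number of `(−1,−1)` edges of the cycle. -/
noncomputable def countMM (σ : AltCycle I M) : ℕ :=
  ((Finset.range σ.len).filter fun i => StepMM I M (σ.vert i) (σ.vert (i + 1))).card

end AltCycle

/-- A size-increasing alternating path (SIAP) for `M`: an `M`-alternating path whose two
endpoints are a man unmatched in `M` and a woman unmatched in `M`, and which has equally
many `(+1,+1)` and `(−1,−1)` edges. -/
def IsSIAP (I : CritInstance A B) (M : Finset (A × B)) (ρ : AltPath I M) : Prop :=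
  (((∃ m, ρ.vert 0 = Sum.inl m ∧ ¬ ManMatched M m) ∧
      (∃ w, ρ.vert ρ.len = Sum.inr w ∧ ¬ WomanMatched M w)) ∨
    ((∃ w, ρ.vert 0 = Sum.inr w ∧ ¬ WomanMatched M w) ∧
      (∃ m, ρ.vert ρ.len = Sum.inl m ∧ ¬ ManMatched M m))) ∧
  ρ.countPP = ρ.countMM

/-- A size-reducing alternating path (SRAP) for `M` with respect to the level assignment
`(lA, lB)`: an `M`-alternating path both of whose terminal edges lie in `M`, starting at a
woman matched in `M` at level 0, ending at a non-critical man at level 1, whose number of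
`(+1,+1)` edges is exactly one more than its number of `(−1,−1)` edges. -/
def IsSRAP (I : CritInstance A B) (M : Finset (A × B)) (lA : A → ℕ) (lB : B → ℕ)
    (ρ : AltPath I M) : Prop :=
  StepM M (ρ.vert 0) (ρ.vert 1) ∧
  StepM M (ρ.vert (ρ.len - 1)) (ρ.vert ρ.len) ∧
  (((∃ w, ρ.vert 0 = Sum.inr w ∧ WomanMatched M w ∧ lB w = 0) ∧
      (∃ m, ρ.vert ρ.len = Sum.inl m ∧ m ∉ I.C ∧ lA m = 1)) ∨
    ((∃ m, ρ.vert 0 = Sum.inl m ∧ m ∉ I.C ∧ lA m = 1) ∧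
      (∃ w, ρ.vert ρ.len = Sum.inr w ∧ WomanMatched M w ∧ lB w = 0))) ∧
  ρ.countPP = ρ.countMM + 1

end CritInstance

namespace CritInstance

variable {A : Type u} {B : Type v} {I : CritInstance A B} {M N : Finset (A × B)}

/-- The vote of man `m` for `N` against `M`. -/
noncomputable def manVote (I : CritInstance A B) (N M : Finset (A × B)) (m : A) : ℤ :=
  (if ManPrefers I N M m then 1 else 0) - (if ManPrefers I M N m then 1 else 0)

/-- The vote of woman `w` for `N` against `M`. -/
noncomputable def womanVote (I : CritInstance A B) (N M : Finset (A × B)) (w : B) : ℤ :=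
  (if WomanPrefers I N M w then 1 else 0) - (if WomanPrefers I M N w then 1 else 0)

theorem phi_sub_phi [Fintype A] [Fintype B] (I : CritInstance A B) (N M : Finset (A × B)) :
    (phi I N M : ℤ) - phi I M N = ∑ m, manVote I N M m + ∑ w, womanVote I N M w := by
  simp only [phi, manVote, womanVote, Finset.sum_sub_distrib, Finset.sum_boole]
  push_cast
  ring

theorem IsMatching.sum_fst [Fintype A] (hN : IsMatching I N) (f : A → ℤ) :
    ∑ e ∈ N, f e.1 = ∑ m, if ManMatched N m then f m else 0 := by
  rw [← Finset.sum_filter]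
  have himage : (Finset.univ.filter fun m => ManMatched N m) = N.image Prod.fst := by
    ext m
    rw [Finset.mem_filter]
    simp [ManMatched]
  rw [himage, Finset.sum_image]
  rintro ⟨m, w⟩ h₁ ⟨m', w'⟩ h₂ (rfl : m = m')
  rw [hN.2.1 h₁ h₂]

theorem IsMatching.sum_snd [Fintype B] (hN : IsMatching I N) (f : B → ℤ) :
    ∑ e ∈ N, f e.2 = ∑ w, if WomanMatched N w then f w else 0 := by
  rw [← Finset.sum_filter]
  have himage : (Finset.univ.filter fun w => WomanMatched N w) = N.image Prod.snd := by
    ext w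
    rw [Finset.mem_filter]
    simp [WomanMatched]
  rw [himage, Finset.sum_image]
  rintro ⟨m, w⟩ h₁ ⟨m', w'⟩ h₂ (rfl : w = w')
  rw [hN.2.2 h₁ h₂]

theorem manVote_of_unmatched {m : A} (hm : ¬ ManMatched N m) :
    manVote I N M m = if ManMatched M m then -1 else 0 := by
  have h₁ : ¬ ManPrefers I N M m := fun ⟨w, hw, _⟩ => hm ⟨w, hw⟩
  have h₂ : ManPrefers I M N m ↔ ManMatched M m :=
    ⟨fun ⟨w, hw, _⟩ => ⟨w, hw⟩, fun ⟨w, hw⟩ => ⟨w, hw, Or.inl hm⟩⟩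
  simp only [manVote, h₁, h₂]
  grind

theorem womanVote_of_unmatched {w : B} (hw : ¬ WomanMatched N w) :
    womanVote I N M w = if WomanMatched M w then -1 else 0 := by
  have h₁ : ¬ WomanPrefers I N M w := fun ⟨m, hm, _⟩ => hw ⟨m, hm⟩
  have h₂ : WomanPrefers I M N w ↔ WomanMatched M w :=
    ⟨fun ⟨m, hm, _⟩ => ⟨m, hm⟩, fun ⟨m, hm⟩ => ⟨m, hm, Or.inl hw⟩⟩
  simp only [womanVote, h₁, h₂]
  grind

theorem manPrefers_iff (hN : IsMatching I N) {m : A} {w : B} (hmw : (m, w) ∈ N) :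
    ManPrefers I N M m ↔ ¬ ManMatched M m ∨ ∃ w', (m, w') ∈ M ∧ I.prefA m w w' := by
  refine ⟨fun ⟨w₁, h₁, h⟩ => ?_, fun h => ⟨w, hmw, h⟩⟩
  rwa [hN.2.1 hmw h₁]

theorem womanPrefers_iff (hN : IsMatching I N) {m : A} {w : B} (hmw : (m, w) ∈ N) :
    WomanPrefers I N M w ↔ ¬ WomanMatched M w ∨ ∃ m', (m', w) ∈ M ∧ I.prefB w m m' := by
  refine ⟨fun ⟨m₁, h₁, h⟩ => ?_, fun h => ⟨m, hmw, h⟩⟩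
  rwa [hN.2.2 hmw h₁]

theorem manPrefers_iff_of_mem (hN : IsMatching I N) {m : A} {w : B} (hmw : (m, w) ∈ N) :
    ManPrefers I M N m ↔ ∃ w', (m, w') ∈ M ∧ I.prefA m w' w := by
  constructor
  · rintro ⟨w', hw', h | ⟨w₁, h₁, h⟩⟩
    · exact absurd ⟨w, hmw⟩ h
    · exact ⟨w', hw', by rwa [hN.2.1 hmw h₁]⟩
  · rintro ⟨w', hw', h⟩
    exact ⟨w', hw', Or.inr ⟨w, hmw, h⟩⟩

theorem womanPrefers_iff_of_mem (hN : IsMatching I N) {m : A} {w : B} (hmw : (m, w) ∈ N) :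
    WomanPrefers I M N w ↔ ∃ m', (m', w) ∈ M ∧ I.prefB w m' m := by
  constructor
  · rintro ⟨m', hm', h | ⟨m₁, h₁, h⟩⟩
    · exact absurd ⟨m, hmw⟩ h
    · exact ⟨m', hm', by rwa [hN.2.2 hmw h₁]⟩
  · rintro ⟨m', hm', h⟩
    exact ⟨m', hm', Or.inr ⟨m, hmw, h⟩⟩

theorem not_manPrefers_swap (hM : IsMatching I M) (hN : IsMatching I N) {m : A}
    (h : ManPrefers I M N m) : ¬ ManPrefers I N M m := by
  rintro ⟨w, hw, h'⟩
  obtain ⟨w₁, h₁, hp₁⟩ := (manPrefers_iff_of_mem hN hw).1 h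
  obtain h' | ⟨w₂, h₂, hp₂⟩ := h'
  · exact h' ⟨w₁, h₁⟩
  · obtain rfl := hM.2.1 h₁ h₂
    exact I.prefA_irrefl _ _ (I.prefA_trans _ _ _ _ hp₁ hp₂)

theorem not_womanPrefers_swap (hM : IsMatching I M) (hN : IsMatching I N) {w : B}
    (h : WomanPrefers I M N w) : ¬ WomanPrefers I N M w := by
  rintro ⟨m, hm, h'⟩
  obtain ⟨m₁, h₁, hp₁⟩ := (womanPrefers_iff_of_mem hN hm).1 h
  obtain h' | ⟨m₂, h₂, hp₂⟩ := h'
  · exact h' ⟨m₁, h₁⟩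
  · obtain rfl := hM.2.2 h₁ h₂
    exact I.prefB_irrefl _ _ (I.prefB_trans _ _ _ _ hp₁ hp₂)

theorem manPrefers_or (hM : IsMatching I M) (hN : IsMatching I N) {m : A} {w : B}
    (hmw : (m, w) ∈ N) (hn : (m, w) ∉ M) : ManPrefers I N M m ∨ ManPrefers I M N m := by
  rw [manPrefers_iff hN hmw, manPrefers_iff_of_mem hN hmw]
  by_cases hm : ManMatched M m
  · obtain ⟨w', hw'⟩ := hm
    have hne : w ≠ w' := by rintro rfl; exact hn hw'
    rcases I.prefA_total m w w' (hN.1 hmw) (hM.1 hw') hne with h | h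
    · exact Or.inl (Or.inr ⟨w', hw', h⟩)
    · exact Or.inr ⟨w', hw', h⟩
  · exact Or.inl (Or.inl hm)

theorem womanPrefers_or (hM : IsMatching I M) (hN : IsMatching I N) {m : A} {w : B}
    (hmw : (m, w) ∈ N) (hn : (m, w) ∉ M) : WomanPrefers I N M w ∨ WomanPrefers I M N w := by
  rw [womanPrefers_iff hN hmw, womanPrefers_iff_of_mem hN hmw]
  by_cases hw : WomanMatched M w
  · obtain ⟨m', hm'⟩ := hw
    have hne : m ≠ m' := by rintro rfl; exact hn hm'
    rcases I.prefB_total w m m' (hN.1 hmw) (hM.1 hm') hne with h | h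
    · exact Or.inl (Or.inr ⟨m', hm', h⟩)
    · exact Or.inr ⟨m', hm', h⟩
  · exact Or.inl (Or.inl hw)

theorem manVote_of_mem_of_mem (hM : IsMatching I M) (hN : IsMatching I N) {m : A} {w : B}
    (hmw : (m, w) ∈ N) (hmM : (m, w) ∈ M) : manVote I N M m = 0 := by
  have aux : ∀ {K L : Finset (A × B)}, IsMatching I K → IsMatching I L →
      (m, w) ∈ K → (m, w) ∈ L → ¬ ManPrefers I K L m := by
    intro K L hK hL h₁ h₂ h
    obtain ⟨w', hw', hp⟩ := (manPrefers_iff_of_mem hL h₂).1 h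
    obtain rfl := hK.2.1 h₁ hw'
    exact I.prefA_irrefl _ _ hp
  simp [manVote, aux hN hM hmw hmM, aux hM hN hmM hmw]

theorem womanVote_of_mem_of_mem (hM : IsMatching I M) (hN : IsMatching I N) {m : A} {w : B}
    (hmw : (m, w) ∈ N) (hmM : (m, w) ∈ M) : womanVote I N M w = 0 := by
  have aux : ∀ {K L : Finset (A × B)}, IsMatching I K → IsMatching I L →
      (m, w) ∈ K → (m, w) ∈ L → ¬ WomanPrefers I K L w := by
    intro K L hK hL h₁ h₂ h
    obtain ⟨m', hm', hp⟩ := (womanPrefers_iff_of_mem hL h₂).1 h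
    obtain rfl := hK.2.2 h₁ hm'
    exact I.prefB_irrefl _ _ hp
  simp [womanVote, aux hN hM hmw hmM, aux hM hN hmM hmw]

/-- The votes along an edge of `N` are bounded by twice the level difference. -/
theorem DomConds.vote_add_vote_le {lA : A → ℕ} {lB : B → ℕ} (h : DomConds I M lA lB)
    (hM : IsMatching I M) (hN : IsMatching I N) {m : A} {w : B} (hmw : (m, w) ∈ N) :
    manVote I N M m + 2 * lA m + (womanVote I N M w - 2 * lB w) ≤ 0 := by
  obtain ⟨hlevel, -, -, -, hpp, hmm, hsteep⟩ := h
  by_cases hmM : (m, w) ∈ M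
  · rw [manVote_of_mem_of_mem hM hN hmw hmM, womanVote_of_mem_of_mem hM hN hmw hmM,
      hlevel m w hmM]
    omega
  · have hE := hN.1 hmw
    have hsteep := hsteep m w hE
    have hA := manPrefers_or hM hN hmw hmM
    have hB := womanPrefers_or hM hN hmw hmM
    have hA' := not_manPrefers_swap (m := m) hM hN
    have hB' := not_womanPrefers_swap (w := w) hM hN
    have hplus : ManPrefers I N M m → WomanPrefers I N M w → lA m < lB w := fun h₁ h₂ =>
      hpp m w ⟨hE, hmM, (manPrefers_iff hN hmw).1 h₁, (womanPrefers_iff hN hmw).1 h₂⟩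
    have hminus : lB w + 1 = lA m → ManPrefers I M N m ∧ WomanPrefers I M N w := fun hl =>
      ⟨(manPrefers_iff_of_mem hN hmw).2 (hmm m w hE hl).2.2.1,
        (womanPrefers_iff_of_mem hN hmw).2 (hmm m w hE hl).2.2.2⟩
    unfold manVote womanVote
    grind

end CritInstance

open CritInstance

/-- If `M` is a feasible matching and some level assignment satisfies the
dominant conditions for `M`, then `φ(N,M) < φ(M,N)` for every feasible matching `N` with
`|N| > |M|`. -/
theorem domConds_beats_larger {A : Type u} {B : Type v} [Fintype A] [Fintype B]
    (I : CritInstance A B) (M : Finset (A × B)) (hM : I.IsFeasible M)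
    (lA : A → ℕ) (lB : B → ℕ) (h : I.DomConds M lA lB) :
    ∀ N, I.IsFeasible N → M.card < N.card → I.phi N M < I.phi M N := by
  intro N hN hcard
  have hedges : ∑ e ∈ N, ((manVote I N M e.1 + 2 * (lA e.1 : ℤ)) +
      (womanVote I N M e.2 - 2 * (lB e.2 : ℤ))) ≤ 0 :=
    Finset.sum_nonpos fun e he => h.vote_add_vote_le hM.1 hN.1 he
  have hlevels : ∑ e ∈ M, (lA e.1 : ℤ) = ∑ e ∈ M, (lB e.2 : ℤ) :=
    Finset.sum_congr rfl fun e he => by rw [h.1 e.1 e.2 he]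
  have hcardM := hM.1.sum_fst fun _ => 1
  have hcardN := hN.1.sum_fst fun _ => 1
  rw [Finset.sum_add_distrib, hN.1.sum_fst fun m => manVote I N M m + 2 * (lA m : ℤ),
    hN.1.sum_snd fun w => womanVote I N M w - 2 * (lB w : ℤ)] at hedges
  rw [hM.1.sum_fst fun m => (lA m : ℤ), hM.1.sum_snd fun w => (lB w : ℤ)] at hlevels
  simp only [Finset.sum_const, nsmul_eq_mul, mul_one] at hcardM hcardN
  obtain ⟨-, hmen, hwomen, hnoncrit, -⟩ := h
  have hA : ∑ m, (manVote I N M m + 2 * (if ManMatched M m then (lA m : ℤ) else 0)) ≤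
      ∑ m, ((if ManMatched N m then manVote I N M m + 2 * (lA m : ℤ) else 0) +
        ((if ManMatched M m then 1 else 0) - (if ManMatched N m then 1 else 0))) := by
    refine Finset.sum_le_sum fun m _ => ?_
    have hlow : ¬ ManMatched N m → lA m ≤ 1 := fun hm => hnoncrit m fun hc => hm (hN.2 m hc)
    have hvote := manVote_of_unmatched (I := I) (M := M) (N := N) (m := m)
    have := hmen m
    grind
  have hB : ∑ w, (womanVote I N M w - 2 * (if WomanMatched M w then (lB w : ℤ) else 0)) ≤
      ∑ w, if WomanMatched N w then womanVote I N M w - 2 * (lB w : ℤ) else 0 := by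
    refine Finset.sum_le_sum fun w _ => ?_
    have hvote := womanVote_of_unmatched (I := I) (M := M) (N := N) (w := w)
    have := hwomen w
    grind
  simp only [Finset.sum_add_distrib, Finset.sum_sub_distrib, ← Finset.mul_sum] at hA hB
  have hphi := phi_sub_phi I N M
  omega
end

section
/- Let M be a popular feasible matching in a marriage instance with critical men, and suppose M is not a dominant feasible matching, i.e., there exists a feasible matching N with |N| > |M| and φ(M,N) ≤ φ(N,M). Then G contains a size-increasing alternating path for M: an M-alternating path whose two endpoints are a man unmatched in M and a woman unmatched in M and which has equal numbers of (+1,+1) edges and (−1,−1) edges. -/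
open Classical

universe u v

section Iterate

variable {V : Type*} {f : V → V}

/-- If `f` is injective on the points it moves, two orbits that meet before reaching a fixed
point can be traced back from the meeting point. -/
theorem iterate_eq_of_iterate_add_eq
    (hinj : ∀ x y, f x ≠ x → f y ≠ y → f x = f y → x = y) {a b : V} {k : ℕ} :
    ∀ i, (∀ j < i, f (f^[j] a) ≠ f^[j] a) → (∀ j < k + i, f (f^[j] b) ≠ f^[j] b) →
      f^[k + i] b = f^[i] a → f^[k] b = a
  | 0, _, _, h => h
  | i + 1, ha, hb, h => by
    rw [← Nat.add_assoc, Function.iterate_succ_apply', Function.iterate_succ_apply'] at h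
    exact iterate_eq_of_iterate_add_eq hinj i (fun j hj => ha j (by omega))
      (fun j hj => hb j (by omega))
      (hinj _ _ (hb _ (by omega)) (ha _ (by omega)) h)

theorem eq_zero_of_iterate_eq {a b : V} (ha : ∀ x, f x ≠ a) {k : ℕ} (h : f^[k] b = a) :
    k = 0 := by
  cases k with
  | zero => rfl
  | succ k => exact absurd (by rwa [Function.iterate_succ_apply'] at h) (ha (f^[k] b))

/-- Two orbits starting outside the range of `f` that meet before reaching a fixed point
coincide. -/
theorem eq_of_iterate_eq_iterate
    (hinj : ∀ x y, f x ≠ x → f y ≠ y → f x = f y → x = y) {a b : V}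
    (ha : ∀ x, f x ≠ a) (hb : ∀ x, f x ≠ b) {i j : ℕ}
    (hi : ∀ k < i, f (f^[k] a) ≠ f^[k] a) (hj : ∀ k < j, f (f^[k] b) ≠ f^[k] b)
    (h : f^[i] a = f^[j] b) : i = j ∧ a = b := by
  wlog hij : i ≤ j generalizing a b i j
  · obtain ⟨h₁, h₂⟩ := this hb ha hj hi h.symm (by omega)
    exact ⟨h₁.symm, h₂.symm⟩
  obtain ⟨k, rfl⟩ := Nat.exists_eq_add_of_le' hij
  have h' := iterate_eq_of_iterate_add_eq hinj i hi hj h.symm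
  obtain rfl := eq_zero_of_iterate_eq ha h'
  exact ⟨by simp, h'.symm⟩

theorem exists_iterate_isFixedPt [Finite V]
    (hinj : ∀ x y, f x ≠ x → f y ≠ y → f x = f y → x = y) {a : V} (ha : ∀ x, f x ≠ a) :
    ∃ L, f (f^[L] a) = f^[L] a ∧ ∀ k < L, f (f^[k] a) ≠ f^[k] a := by
  have hex : ∃ L, f (f^[L] a) = f^[L] a := by
    by_contra! hne
    exact not_injective_infinite_finite (fun i : ℕ => f^[i] a) fun i j hij =>
      (eq_of_iterate_eq_iterate hinj ha ha (fun k _ => hne k) (fun k _ => hne k) hij).1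
  exact ⟨Nat.find hex, Nat.find_spec hex, fun k hk => Nat.find_min hex hk⟩

end Iterate

namespace CritInstance

variable {A : Type u} {B : Type v} {I : CritInstance A B} {M N X Y Z : Finset (A × B)}

/-- Move from a man to his `N`-partner and from a woman to her `M`-partner; vertices without
such a partner are fixed. -/
noncomputable def exchangeStep (M N : Finset (A × B)) : A ⊕ B → A ⊕ B
  | Sum.inl m => if h : ManMatched N m then Sum.inr h.choose else Sum.inl m
  | Sum.inr w => if h : WomanMatched M w then Sum.inl h.choose else Sum.inr w

theorem exchangeStep_inl (hN : I.IsMatching N) {m : A} {w : B} (h : (m, w) ∈ N) :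
    exchangeStep M N (Sum.inl m) = Sum.inr w := by
  have hm : ManMatched N m := ⟨w, h⟩
  rw [exchangeStep, dif_pos hm, hN.2.1 hm.choose_spec h]

theorem exchangeStep_inr (hM : I.IsMatching M) {m : A} {w : B} (h : (m, w) ∈ M) :
    exchangeStep M N (Sum.inr w) = Sum.inl m := by
  have hw : WomanMatched M w := ⟨m, h⟩
  rw [exchangeStep, dif_pos hw, hM.2.2 hw.choose_spec h]

theorem exchangeStep_ne_cases {x : A ⊕ B} (h : exchangeStep M N x ≠ x) :
    (∃ m w, x = Sum.inl m ∧ exchangeStep M N x = Sum.inr w ∧ (m, w) ∈ N) ∨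
      (∃ m w, x = Sum.inr w ∧ exchangeStep M N x = Sum.inl m ∧ (m, w) ∈ M) := by
  rcases x with m | w
  · by_cases hm : ManMatched N m
    · exact Or.inl ⟨m, hm.choose, rfl, dif_pos hm, hm.choose_spec⟩
    · exact absurd (dif_neg hm) h
  · by_cases hw : WomanMatched M w
    · exact Or.inr ⟨hw.choose, w, rfl, dif_pos hw, hw.choose_spec⟩
    · exact absurd (dif_neg hw) h

theorem not_manMatched_of_exchangeStep_eq {m : A}
    (h : exchangeStep M N (Sum.inl m) = Sum.inl m) : ¬ ManMatched N m := fun hm => by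
  rw [exchangeStep, dif_pos hm] at h
  exact Sum.inr_ne_inl h

theorem not_womanMatched_of_exchangeStep_eq {w : B}
    (h : exchangeStep M N (Sum.inr w) = Sum.inr w) : ¬ WomanMatched M w := fun hw => by
  rw [exchangeStep, dif_pos hw] at h
  exact Sum.inl_ne_inr h

theorem exchangeStep_injOn_moved (hM : I.IsMatching M) (hN : I.IsMatching N) (x y : A ⊕ B)
    (hx : exchangeStep M N x ≠ x) (hy : exchangeStep M N y ≠ y)
    (h : exchangeStep M N x = exchangeStep M N y) : x = y := by
  rcases exchangeStep_ne_cases hx with ⟨m, w, hxm, hx', hmem⟩ | ⟨m, w, hxw, hx', hmem⟩ <;>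
    rcases exchangeStep_ne_cases hy with ⟨m', w', hym, hy', hmem'⟩ | ⟨m', w', hyw, hy', hmem'⟩ <;>
    rw [hx', hy'] at h
  · obtain rfl := Sum.inr_injective h
    rw [hxm, hym, hN.2.2 hmem hmem']
  · exact absurd h Sum.inr_ne_inl
  · exact absurd h Sum.inl_ne_inr
  · obtain rfl := Sum.inl_injective h
    rw [hxw, hyw, hM.2.1 hmem hmem']

theorem exchangeStep_ne_inl {m : A} (hmM : ¬ ManMatched M m) (hmN : ManMatched N m)
    (x : A ⊕ B) : exchangeStep M N x ≠ Sum.inl m := by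
  intro h
  by_cases hx : exchangeStep M N x = x
  · obtain rfl : x = Sum.inl m := hx.symm.trans h
    exact not_manMatched_of_exchangeStep_eq h hmN
  · rcases exchangeStep_ne_cases hx with ⟨m', w, -, h', -⟩ | ⟨m', w, -, h', hmem⟩ <;> rw [h'] at h
    · exact Sum.inr_ne_inl h
    · obtain rfl := Sum.inl_injective h
      exact hmM ⟨w, hmem⟩

theorem card_filter_manMatched [Fintype A] (hM : I.IsMatching M) :
    (Finset.univ.filter fun m : A => ManMatched M m).card = M.card := by
  have h : (Finset.univ.filter fun m : A => ManMatched M m) = M.image Prod.fst := by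
    ext m
    rw [Finset.mem_filter]
    simp [ManMatched]
  rw [h, Finset.card_image_of_injOn]
  rintro ⟨m, w⟩ hmw ⟨m', w'⟩ hmw' hmm
  obtain rfl : m = m' := hmm
  rw [hM.2.1 hmw hmw']

/-- If `N` is larger than `M`, some orbit of `exchangeStep M N` leads from a man matched only
in `N` to a woman unmatched in `M`. -/
theorem exists_augmenting_orbit [Fintype A] [Fintype B] (hM : I.IsMatching M)
    (hN : I.IsMatching N) (hcard : M.card < N.card) :
    ∃ m w L, ¬ ManMatched M m ∧ ManMatched N m ∧ ¬ WomanMatched M w ∧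
      (exchangeStep M N)^[L] (Sum.inl m) = Sum.inr w ∧
      ∀ k < L, exchangeStep M N ((exchangeStep M N)^[k] (Sum.inl m)) ≠
        (exchangeStep M N)^[k] (Sum.inl m) := by
  by_contra! hcon
  have hinj := exchangeStep_injOn_moved (M := M) (N := N) hM hN
  have hend : ∀ m, ∃ m', ¬ ManMatched M m → ManMatched N m →
      (¬ ManMatched N m' ∧ ManMatched M m') ∧ ∃ L,
      (exchangeStep M N)^[L] (Sum.inl m) = Sum.inl m' ∧
      ∀ k < L, exchangeStep M N ((exchangeStep M N)^[k] (Sum.inl m)) ≠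
        (exchangeStep M N)^[k] (Sum.inl m) := by
    intro m
    by_cases hm : ¬ ManMatched M m ∧ ManMatched N m
    swap
    · exact ⟨m, fun h h' => absurd ⟨h, h'⟩ hm⟩
    obtain ⟨L, hfix, hmov⟩ := exists_iterate_isFixedPt hinj (exchangeStep_ne_inl hm.1 hm.2)
    rcases hL : (exchangeStep M N)^[L] (Sum.inl m) with m' | w <;> rw [hL] at hfix
    · have hm' := not_manMatched_of_exchangeStep_eq hfix
      refine ⟨m', fun _ _ => ⟨⟨hm', ?_⟩, L, hL, hmov⟩⟩
      cases L with
      | zero =>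
        obtain rfl : m = m' := Sum.inl_injective hL
        exact absurd hm.2 hm'
      | succ L =>
        rw [Function.iterate_succ_apply'] at hL
        rcases exchangeStep_ne_cases (hmov L (by omega)) with
          ⟨m₁, w, -, h, -⟩ | ⟨m₁, w, -, h, hmem⟩ <;> rw [h] at hL
        · exact absurd hL Sum.inr_ne_inl
        · obtain rfl := Sum.inl_injective hL
          exact ⟨w, hmem⟩
    · obtain ⟨k, hk, hk'⟩ :=
        hcon m w L hm.1 hm.2 (not_womanMatched_of_exchangeStep_eq hfix) hL
      exact absurd hk' (hmov k hk)
  choose e he using hend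
  rw [← card_filter_manMatched hM, ← card_filter_manMatched hN,
    ← Finset.card_sdiff_lt_card_sdiff_iff] at hcard
  obtain ⟨m, hm, m', hm', hne, heq⟩ :=
    Finset.exists_ne_map_eq_of_card_lt_of_maps_to (f := e) hcard (by
      intro m hm
      simp only [Finset.coe_sdiff, Finset.coe_filter, Finset.mem_univ, true_and, Set.mem_sdiff,
        Set.mem_ofPred_eq] at hm ⊢
      exact (he m hm.2 hm.1).1.symm)
  simp only [Finset.mem_sdiff, Finset.mem_filter, Finset.mem_univ, true_and] at hm hm'
  obtain ⟨-, L, hL, hmov⟩ := he m hm.2 hm.1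
  obtain ⟨-, L', hL', hmov'⟩ := he m' hm'.2 hm'.1
  exact hne (Sum.inl_injective (eq_of_iterate_eq_iterate hinj (exchangeStep_ne_inl hm.2 hm.1)
    (exchangeStep_ne_inl hm'.2 hm'.1) hmov hmov' (by rw [hL, hL', heq])).2)

/-- Each man's vote when comparing `X` with `Y`. -/
noncomputable def vote (I : CritInstance A B) (X Y : Finset (A × B)) : A ⊕ B → ℤ
  | Sum.inl m => (if I.ManPrefers X Y m then 1 else 0) - (if I.ManPrefers Y X m then 1 else 0)
  | Sum.inr w => (if I.WomanPrefers X Y w then 1 else 0) - (if I.WomanPrefers Y X w then 1 else 0)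

theorem vote_self (x : A ⊕ B) : I.vote X X x = 0 := by
  cases x <;> simp [vote]

theorem sum_vote [Fintype A] [Fintype B] :
    ∑ x, I.vote X Y x = (I.phi X Y : ℤ) - I.phi Y X := by
  simp only [Fintype.sum_sum_type, vote, phi, Finset.sum_sub_distrib, Finset.card_filter]
  push_cast
  ring

/-- The edge set agreeing with `Y` at the men in `S` and with `X` at the other men. -/
noncomputable def swapOn (S : Set (A ⊕ B)) (X Y : Finset (A × B)) : Finset (A × B) :=
  X.filter (fun e => Sum.inl e.1 ∉ S) ∪ Y.filter fun e => Sum.inl e.1 ∈ S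

/-- `S` is a union of components of the matching `X`. -/
def ClosedUnder (S : Set (A ⊕ B)) (X : Finset (A × B)) : Prop :=
  ∀ m w, (m, w) ∈ X → (Sum.inl m ∈ S ↔ Sum.inr w ∈ S)

variable {S : Set (A ⊕ B)}

theorem mem_swapOn_left {m : A} {w : B} :
    (m, w) ∈ swapOn S X Y ↔ if Sum.inl m ∈ S then (m, w) ∈ Y else (m, w) ∈ X := by
  by_cases h : (Sum.inl m : A ⊕ B) ∈ S <;> simp [swapOn, h]

theorem mem_swapOn_right (hX : ClosedUnder S X) (hY : ClosedUnder S Y) {m : A} {w : B} :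
    (m, w) ∈ swapOn S X Y ↔ if Sum.inr w ∈ S then (m, w) ∈ Y else (m, w) ∈ X := by
  have := hX m w
  have := hY m w
  rw [mem_swapOn_left]
  split_ifs <;> tauto

theorem IsFeasible.swapOn (hX : I.IsFeasible X) (hY : I.IsFeasible Y)
    (hSX : ClosedUnder S X) (hSY : ClosedUnder S Y) : I.IsFeasible (swapOn S X Y) := by
  refine ⟨⟨?_, ?_, ?_⟩, ?_⟩
  · exact Finset.union_subset ((Finset.filter_subset _ _).trans hX.1.1)
      ((Finset.filter_subset _ _).trans hY.1.1)
  · intro m w w' h h'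
    rw [mem_swapOn_left] at h h'
    split_ifs at h h'
    · exact hY.1.2.1 h h'
    · exact hX.1.2.1 h h'
  · intro m m' w h h'
    rw [mem_swapOn_right hSX hSY] at h h'
    split_ifs at h h'
    · exact hY.1.2.2 h h'
    · exact hX.1.2.2 h h'
  · intro m hm
    by_cases h : (Sum.inl m : A ⊕ B) ∈ S <;>
      simp only [ManMatched, mem_swapOn_left, h, if_true, if_false]
    · exact hY.2 m hm
    · exact hX.2 m hm

theorem vote_swapOn (hX : ClosedUnder S X) (hY : ClosedUnder S Y) (x : A ⊕ B) :
    I.vote (swapOn S X Y) Z x = if x ∈ S then I.vote Y Z x else I.vote X Z x := by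
  rcases x with m | w
  · by_cases h : (Sum.inl m : A ⊕ B) ∈ S <;>
      simp only [vote, ManPrefers, ManMatched, mem_swapOn_left, h, if_true, if_false] <;> congr
  · by_cases h : (Sum.inr w : A ⊕ B) ∈ S <;>
      simp only [vote, WomanPrefers, WomanMatched, mem_swapOn_right hX hY, h, if_true, if_false] <;>
      congr

/-- On a union of components of two tied matchings, one of them popular, the votes cancel. -/
theorem sum_vote_eq_zero_of_closedUnder [Fintype A] [Fintype B] (hM : I.IsPFM M)
    (hN : I.IsFeasible N) (hphi : I.phi M N ≤ I.phi N M)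
    (hSM : ClosedUnder S M) (hSN : ClosedUnder S N) :
    ∑ x, (if x ∈ S then I.vote N M x else 0) = 0 := by
  have h₁ := hM.2 _ (hM.1.swapOn hN hSM hSN)
  have h₂ := hM.2 _ (hN.swapOn hM.1 hSN hSM)
  have e₁ := sum_vote (I := I) (X := swapOn S M N) (Y := M)
  have e₂ := sum_vote (I := I) (X := swapOn S N M) (Y := M)
  have e₃ := sum_vote (I := I) (X := N) (Y := M)
  simp only [vote_swapOn hSM hSN, vote_swapOn hSN hSM, vote_self] at e₁ e₂
  have e₄ : ∑ x, I.vote N M x = ∑ x, (if x ∈ S then I.vote N M x else 0) +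
      ∑ x, (if x ∈ S then 0 else I.vote N M x) := by
    rw [← Finset.sum_add_distrib]
    refine Finset.sum_congr rfl fun x _ => ?_
    split_ifs <;> simp
  omega

theorem vote_inl_cases (hM : I.IsMatching M) (hN : I.IsMatching N) {m : A} {w : B}
    (hmN : (m, w) ∈ N) (hmM : (m, w) ∉ M) :
    ((¬ ManMatched M m ∨ ∃ w', (m, w') ∈ M ∧ I.prefA m w w') ∧
      ¬ (∃ w', (m, w') ∈ M ∧ I.prefA m w' w) ∧ I.vote N M (Sum.inl m) = 1) ∨
    (¬ (¬ ManMatched M m ∨ ∃ w', (m, w') ∈ M ∧ I.prefA m w w') ∧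
      (∃ w', (m, w') ∈ M ∧ I.prefA m w' w) ∧ I.vote N M (Sum.inl m) = -1) := by
  have hP : I.ManPrefers N M m ↔ (¬ ManMatched M m ∨ ∃ w', (m, w') ∈ M ∧ I.prefA m w w') :=
    ⟨fun ⟨w₁, h₁, h⟩ => by rwa [hN.2.1 hmN h₁], fun h => ⟨w, hmN, h⟩⟩
  have hQ : I.ManPrefers M N m ↔ ∃ w', (m, w') ∈ M ∧ I.prefA m w' w := by
    constructor
    · rintro ⟨w', h', h | ⟨w₁, h₁, h⟩⟩
      · exact absurd ⟨w, hmN⟩ h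
      · exact ⟨w', h', by rwa [hN.2.1 hmN h₁]⟩
    · rintro ⟨w', h', h⟩
      exact ⟨w', h', Or.inr ⟨w, hmN, h⟩⟩
  by_cases hm : ManMatched M m
  · obtain ⟨w₁, h₁⟩ := hm
    have hne : w ≠ w₁ := by
      rintro rfl
      exact hmM h₁
    have hex : ∀ p : B → Prop, (∃ w', (m, w') ∈ M ∧ p w') ↔ p w₁ := fun p =>
      ⟨fun ⟨w', h', h⟩ => by rwa [hM.2.1 h₁ h'], fun h => ⟨w₁, h₁, h⟩⟩
    have hm : ManMatched M m := ⟨w₁, h₁⟩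
    simp only [hex, hm, not_true_eq_false, false_or] at hP hQ ⊢
    simp only [vote, hP, hQ]
    rcases I.prefA_total m w w₁ (hN.1 hmN) (hM.1 h₁) hne with h | h
    · have h' : ¬ I.prefA m w₁ w := fun h' => I.prefA_irrefl _ _ (I.prefA_trans _ _ _ _ h h')
      simp [h, h']
    · have h' : ¬ I.prefA m w w₁ := fun h' => I.prefA_irrefl _ _ (I.prefA_trans _ _ _ _ h h')
      simp [h, h']
  · have hq : ¬ ∃ w', (m, w') ∈ M ∧ I.prefA m w' w := fun ⟨w', h', _⟩ => hm ⟨w', h'⟩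
    exact Or.inl ⟨Or.inl hm, hq, by simp [vote, hP, hQ, hm, hq]⟩

theorem vote_inr_cases (hM : I.IsMatching M) (hN : I.IsMatching N) {m : A} {w : B}
    (hmN : (m, w) ∈ N) (hmM : (m, w) ∉ M) :
    ((¬ WomanMatched M w ∨ ∃ m', (m', w) ∈ M ∧ I.prefB w m m') ∧
      ¬ (∃ m', (m', w) ∈ M ∧ I.prefB w m' m) ∧ I.vote N M (Sum.inr w) = 1) ∨
    (¬ (¬ WomanMatched M w ∨ ∃ m', (m', w) ∈ M ∧ I.prefB w m m') ∧
      (∃ m', (m', w) ∈ M ∧ I.prefB w m' m) ∧ I.vote N M (Sum.inr w) = -1) := by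
  have hP : I.WomanPrefers N M w ↔
      (¬ WomanMatched M w ∨ ∃ m', (m', w) ∈ M ∧ I.prefB w m m') :=
    ⟨fun ⟨m₁, h₁, h⟩ => by rwa [hN.2.2 hmN h₁], fun h => ⟨m, hmN, h⟩⟩
  have hQ : I.WomanPrefers M N w ↔ ∃ m', (m', w) ∈ M ∧ I.prefB w m' m := by
    constructor
    · rintro ⟨m', h', h | ⟨m₁, h₁, h⟩⟩
      · exact absurd ⟨m, hmN⟩ h
      · exact ⟨m', h', by rwa [hN.2.2 hmN h₁]⟩
    · rintro ⟨m', h', h⟩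
      exact ⟨m', h', Or.inr ⟨m, hmN, h⟩⟩
  by_cases hw : WomanMatched M w
  · obtain ⟨m₁, h₁⟩ := hw
    have hne : m ≠ m₁ := by
      rintro rfl
      exact hmM h₁
    have hex : ∀ p : A → Prop, (∃ m', (m', w) ∈ M ∧ p m') ↔ p m₁ := fun p =>
      ⟨fun ⟨m', h', h⟩ => by rwa [hM.2.2 h₁ h'], fun h => ⟨m₁, h₁, h⟩⟩
    have hw : WomanMatched M w := ⟨m₁, h₁⟩
    simp only [hex, hw, not_true_eq_false, false_or] at hP hQ ⊢
    simp only [vote, hP, hQ]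
    rcases I.prefB_total w m m₁ (hN.1 hmN) (hM.1 h₁) hne with h | h
    · have h' : ¬ I.prefB w m₁ m := fun h' => I.prefB_irrefl _ _ (I.prefB_trans _ _ _ _ h h')
      simp [h, h']
    · have h' : ¬ I.prefB w m m₁ := fun h' => I.prefB_irrefl _ _ (I.prefB_trans _ _ _ _ h h')
      simp [h, h']
  · have hq : ¬ ∃ m', (m', w) ∈ M ∧ I.prefB w m' m := fun ⟨m', h', _⟩ => hw ⟨m', h'⟩
    exact Or.inl ⟨Or.inl hw, hq, by simp [vote, hP, hQ, hw, hq]⟩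

theorem vote_add_vote (hM : I.IsMatching M) (hN : I.IsMatching N) {m : A} {w : B}
    (hmN : (m, w) ∈ N) (hmM : (m, w) ∉ M) :
    I.vote N M (Sum.inl m) + I.vote N M (Sum.inr w) =
      2 * ((if I.StepPP M (Sum.inl m) (Sum.inr w) then 1 else 0) -
        (if I.StepMM M (Sum.inl m) (Sum.inr w) then 1 else 0)) := by
  have hE := hN.1 hmN
  rcases vote_inl_cases hM hN hmN hmM with ⟨h₁, h₂, h₃⟩ | ⟨h₁, h₂, h₃⟩ <;>
    rcases vote_inr_cases hM hN hmN hmM with ⟨k₁, k₂, k₃⟩ | ⟨k₁, k₂, k₃⟩ <;>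
    rw [h₃, k₃] <;>
    simp only [StepPP, StepMM, PlusPlus, MinusMinus, hE, hmM, h₁, h₂, k₁, k₂] <;> norm_num

/-- The vertices `v 0, …, v L` form an augmenting path for `M`, from an unmatched man to an
unmatched woman, whose edges outside `M` are taken from `N`. -/
structure IsAugmentingPath (M N : Finset (A × B)) (v : ℕ → A ⊕ B) (L : ℕ) : Prop where
  start : ∃ m, v 0 = Sum.inl m ∧ ¬ ManMatched M m
  finish : ∃ w, v L = Sum.inr w ∧ ¬ WomanMatched M w
  inj : ∀ i j, i ≤ L → j ≤ L → v i = v j → i = j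
  step : ∀ k < L,
    (∃ m w, v k = Sum.inl m ∧ v (k + 1) = Sum.inr w ∧ (m, w) ∈ N ∧ (m, w) ∉ M) ∨
      (∃ m w, v k = Sum.inr w ∧ v (k + 1) = Sum.inl m ∧ (m, w) ∈ M)

theorem exists_isAugmentingPath [Fintype A] [Fintype B] (hM : I.IsMatching M)
    (hN : I.IsMatching N) (hcard : M.card < N.card) : ∃ v L, IsAugmentingPath M N v L := by
  obtain ⟨m₀, w₀, L, hmM, hmN, hw, hL, hmov⟩ := exists_augmenting_orbit hM hN hcard
  have hne := exchangeStep_ne_inl hmM hmN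
  have hinj : ∀ i j, i ≤ L → j ≤ L → (exchangeStep M N)^[i] (Sum.inl m₀) =
      (exchangeStep M N)^[j] (Sum.inl m₀) → i = j := fun i j hi hj h =>
    (eq_of_iterate_eq_iterate (exchangeStep_injOn_moved hM hN) hne hne
      (fun k hk => hmov k (by omega)) (fun k hk => hmov k (by omega)) h).1
  refine ⟨fun i => (exchangeStep M N)^[i] (Sum.inl m₀), L, ⟨m₀, rfl, hmM⟩, ⟨w₀, hL, hw⟩, hinj,
    fun k hk => ?_⟩
  simp only [Function.iterate_succ_apply']
  rcases exchangeStep_ne_cases (hmov k hk) with ⟨m, w, h, h', hmem⟩ | h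
  · refine Or.inl ⟨m, w, h, h', hmem, fun hmem' => ?_⟩
    rw [← Function.iterate_succ_apply' (exchangeStep M N)] at h'
    rcases Nat.lt_or_ge (k + 1) L with hkL | hkL
    · have := hinj (k + 2) k hkL hk.le (by
        rw [Function.iterate_succ_apply', h', h, exchangeStep_inr hM hmem'])
      omega
    · obtain rfl : k + 1 = L := by omega
      obtain rfl := Sum.inr_injective (h'.symm.trans hL)
      exact hw ⟨m, hmem'⟩
  · exact Or.inr h

namespace IsAugmentingPath

variable {v : ℕ → A ⊕ B} {L : ℕ}

theorem closedUnder_left (h : IsAugmentingPath M N v L) (hM : I.IsMatching M) :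
    ClosedUnder (Set.image v (Set.Iic L)) M := by
  intro m w hmw
  constructor
  · rintro ⟨i, hi, him⟩
    cases i with
    | zero =>
      obtain ⟨m₀, h₀, hm₀⟩ := h.start
      obtain rfl := Sum.inl_injective (him.symm.trans h₀)
      exact absurd ⟨w, hmw⟩ hm₀
    | succ i =>
      rcases h.step i hi with ⟨m', w', -, h', -⟩ | ⟨m', w', h₁, h', hmem⟩
      · exact absurd (him.symm.trans h') Sum.inl_ne_inr
      · obtain rfl := Sum.inl_injective (him.symm.trans h')
        exact ⟨i, Nat.le_of_succ_le hi, by rw [h₁, hM.2.1 hmem hmw]⟩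
  · rintro ⟨i, hi, hiw⟩
    rcases (Set.mem_Iic.1 hi).lt_or_eq with hi | rfl
    · rcases h.step i hi with ⟨m', w', h₁, -⟩ | ⟨m', w', h₁, h', hmem⟩
      · exact absurd (hiw.symm.trans h₁) Sum.inr_ne_inl
      · obtain rfl := Sum.inr_injective (hiw.symm.trans h₁)
        exact ⟨i + 1, hi, by rw [h', hM.2.2 hmem hmw]⟩
    · obtain ⟨w₀, h₀, hw₀⟩ := h.finish
      obtain rfl := Sum.inr_injective (hiw.symm.trans h₀)
      exact absurd ⟨m, hmw⟩ hw₀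

theorem closedUnder_right (h : IsAugmentingPath M N v L) (hN : I.IsMatching N) :
    ClosedUnder (Set.image v (Set.Iic L)) N := by
  intro m w hmw
  constructor
  · rintro ⟨i, hi, him⟩
    rcases (Set.mem_Iic.1 hi).lt_or_eq with hi | rfl
    · rcases h.step i hi with ⟨m', w', h₁, h', hmem, -⟩ | ⟨m', w', h₁, -⟩
      · obtain rfl := Sum.inl_injective (him.symm.trans h₁)
        exact ⟨i + 1, hi, by rw [h', hN.2.1 hmem hmw]⟩
      · exact absurd (him.symm.trans h₁) Sum.inl_ne_inr
    · obtain ⟨w₀, h₀, -⟩ := h.finish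
      exact absurd (him.symm.trans h₀) Sum.inl_ne_inr
  · rintro ⟨i, hi, hiw⟩
    cases i with
    | zero =>
      obtain ⟨m₀, h₀, -⟩ := h.start
      exact absurd (hiw.symm.trans h₀) Sum.inr_ne_inl
    | succ i =>
      rcases h.step i hi with ⟨m', w', h₁, h', hmem, -⟩ | ⟨m', w', -, h', -⟩
      · obtain rfl := Sum.inr_injective (hiw.symm.trans h')
        exact ⟨i, Nat.le_of_succ_le hi, by rw [h₁, hN.2.2 hmem hmw]⟩
      · exact absurd (hiw.symm.trans h') Sum.inr_ne_inl

/-- An augmenting path as an alternating path. -/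
def altPath (h : IsAugmentingPath M N v L) (hM : I.IsMatching M) (hN : I.IsMatching N) :
    AltPath I M where
  len := L
  len_pos := by
    obtain ⟨m, hm, -⟩ := h.start
    obtain ⟨w, hw, -⟩ := h.finish
    rcases Nat.eq_zero_or_pos L with rfl | hL
    · exact absurd (hm.symm.trans hw) Sum.inl_ne_inr
    · exact hL
  vert := v
  inj := h.inj
  adj i hi := by
    rcases h.step i hi with ⟨m, w, h₁, h₂, hmem, -⟩ | ⟨m, w, h₁, h₂, hmem⟩ <;> rw [h₁, h₂]
    · exact hN.1 hmem
    · exact hM.1 hmem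
  alternate i hi := by
    rcases h.step i (by omega) with ⟨m, w, h₁, h₂, -, hmem⟩ | ⟨m, w, h₁, h₂, hmem⟩ <;>
      rcases h.step (i + 1) hi with ⟨m', w', k₁, k₂, -, hmem'⟩ | ⟨m', w', k₁, k₂, hmem'⟩
    · exact absurd (h₂.symm.trans k₁) Sum.inr_ne_inl
    · rw [k₂, k₁, h₁]
      obtain rfl := Sum.inr_injective (h₂.symm.trans k₁)
      exact iff_of_false hmem (not_not_intro hmem')
    · rw [k₂, k₁, h₁]
      obtain rfl := Sum.inl_injective (h₂.symm.trans k₁)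
      exact iff_of_true hmem hmem'
    · exact absurd (h₂.symm.trans k₁) Sum.inl_ne_inr

theorem sum_vote_range (h : IsAugmentingPath M N v L) (hM : I.IsMatching M)
    (hN : I.IsMatching N) : ∀ i ≤ L,
    ∑ j ∈ Finset.range i, 2 * ((if I.StepPP M (v j) (v (j + 1)) then (1 : ℤ) else 0) -
        (if I.StepMM M (v j) (v (j + 1)) then 1 else 0)) =
      ∑ j ∈ Finset.range i, I.vote N M (v j) +
        if (v i).isRight then I.vote N M (v i) else 0 := by
  intro i hi
  induction i with
  | zero =>
    obtain ⟨m, hm, -⟩ := h.start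
    simp [hm]
  | succ i ih =>
    rw [Finset.sum_range_succ, Finset.sum_range_succ, ih (by omega)]
    rcases h.step i hi with ⟨m, w, h₁, h₂, hmN, hmM⟩ | ⟨m, w, h₁, h₂, hmM⟩ <;> rw [h₁, h₂]
    · rw [← vote_add_vote hM hN hmN hmM]
      simp [add_assoc]
    · simp [StepPP, StepMM, PlusPlus, MinusMinus, hmM]

theorem countPP_eq_countMM [Fintype A] [Fintype B] (h : IsAugmentingPath M N v L)
    (hM : I.IsPFM M) (hN : I.IsFeasible N) (hphi : I.phi M N ≤ I.phi N M) :
    (h.altPath hM.1.1 hN.1).countPP = (h.altPath hM.1.1 hN.1).countMM := by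
  have hzero := sum_vote_eq_zero_of_closedUnder hM hN hphi (h.closedUnder_left hM.1.1)
    (h.closedUnder_right hN.1)
  have himage : ∀ x, x ∈ Set.image v (Set.Iic L) ↔ x ∈ (Finset.range (L + 1)).image v := fun x => by
    simp
  simp only [himage] at hzero
  rw [Finset.sum_ite_mem, Finset.univ_inter, Finset.sum_image fun i hi j hj hij =>
    h.inj i j (by simpa [Nat.lt_succ_iff] using hi) (by simpa [Nat.lt_succ_iff] using hj) hij,
    Finset.sum_range_succ] at hzero
  have hsum := h.sum_vote_range hM.1.1 hN.1 L le_rfl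
  obtain ⟨w, hw, -⟩ := h.finish
  rw [hw] at hsum hzero
  rw [Sum.isRight_inr, if_pos rfl, hzero, ← Finset.mul_sum, Finset.sum_sub_distrib] at hsum
  have hP : ((h.altPath hM.1.1 hN.1).countPP : ℤ) =
      ∑ j ∈ Finset.range L, if I.StepPP M (v j) (v (j + 1)) then 1 else 0 := by
    rw [AltPath.countPP, Finset.card_filter]
    push_cast
    rfl
  have hQ : ((h.altPath hM.1.1 hN.1).countMM : ℤ) =
      ∑ j ∈ Finset.range L, if I.StepMM M (v j) (v (j + 1)) then 1 else 0 := by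
    rw [AltPath.countMM, Finset.card_filter]
    push_cast
    rfl
  omega

end IsAugmentingPath

end CritInstance

/-- If `M` is a popular feasible matching that is not dominant (there is
a feasible matching `N` with `|N| > |M|` and `φ(M,N) ≤ φ(N,M)`), then there exists a
size-increasing alternating path for `M`. -/
theorem exists_SIAP {A : Type u} {B : Type v} [Fintype A] [Fintype B]
    (I : CritInstance A B) (M : Finset (A × B)) (hM : I.IsPFM M)
    (hnotdom : ∃ N, I.IsFeasible N ∧ M.card < N.card ∧ I.phi M N ≤ I.phi N M) :
    ∃ ρ : CritInstance.AltPath I M, CritInstance.IsSIAP I M ρ := by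
  obtain ⟨N, hN, hcard, hphi⟩ := hnotdom
  obtain ⟨v, L, h⟩ := CritInstance.exists_isAugmentingPath hM.1.1 hN.1 hcard
  exact ⟨h.altPath hM.1.1 hN.1, Or.inl ⟨h.start, h.finish⟩, h.countPP_eq_countMM hM hN hphi⟩
end
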